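/- arXiv:1408.4716 — 5 statements merged into one kernel-verified Lean document; each statement's English description precedes it below -/
import Mathlib

section
/- Let P ⊆ ℝ^d be a d-dimensional k-template (d ≥ 1, k ≥ 2), let I ⊆ {0,…,d−1} be a distinguisher for P with |I| = e(P), and let Q = {x ∈ ℝ^d : x agrees with some y ∈ P on all coordinates in I, and x_i = 0 for all i ∉ I}. Then χ(L(ℝ^d,Q)) equals the least cardinal κ such that κ^{+(e(P)−1)} ≥ 2^{ℵ₀}. -/
open Cardinal

/-- A hypergraph with vertex type `V` is identified with its set of edges
`E : Set (Set V)`.  It is `κ`-colorable if there is a function from `V` to a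
set of cardinality at most `κ` that is not constant on any edge. -/
def HGColorable {V : Type} (E : Set (Set V)) (κ : Cardinal) : Prop :=
  ∃ (α : Type) (φ : V → α), #α ≤ κ ∧ ∀ e ∈ E, ∃ x ∈ e, ∃ y ∈ e, φ x ≠ φ y

/-- The chromatic number of a hypergraph: the least cardinal `κ` such that it
has a proper `κ`-coloring. -/
noncomputable def chrNum {V : Type} (E : Set (Set V)) : Cardinal :=
  sInf {κ | HGColorable E κ}

/-- `cardSucc κ m = κ^{+m}`, the `m`-fold cardinal successor of `κ`. -/
noncomputable def cardSucc (κ : Cardinal) (m : ℕ) : Cardinal := (Order.succ)^[m] κ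

/-- `Q` is a homomorphic image of the set `P` of `d`-tuples: there is a
surjection `f : P → Q` such that `x i = y i` implies `f x i = f y i`. -/
def IsHomImage {d : ℕ} {A : Type} {B : Fin d → Type} (P : Set (Fin d → A))
    (Q : Set (∀ i, B i)) : Prop :=
  ∃ f : (Fin d → A) → (∀ i, B i),
    Set.MapsTo f P Q ∧ Set.SurjOn f P Q ∧
    ∀ x ∈ P, ∀ y ∈ P, ∀ i, x i = y i → f x i = f y i

/-- The edges of the template hypergraph `L(X, P)` where `X = Π i, B i`:
the `k`-element subsets of the vertex set that are homomorphic images of `P`. -/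
def templateEdges (k : ℕ) {d : ℕ} {A : Type} {B : Fin d → Type}
    (P : Set (Fin d → A)) : Set (Set (∀ i, B i)) :=
  {Q | Q.ncard = k ∧ IsHomImage P Q}

/-- `I` is a distinguisher for `P`: any two distinct members of `P` differ at
some coordinate in `I`. -/
def IsDistinguisher {d : ℕ} {A : Type} (P : Set (Fin d → A)) (I : Finset (Fin d)) : Prop :=
  ∀ x ∈ P, ∀ y ∈ P, x ≠ y → ∃ i ∈ I, x i ≠ y i

/-- `eDim P = e(P)`, the least cardinality of a distinguisher for `P`. -/
noncomputable def eDim {d : ℕ} {A : Type} (P : Set (Fin d → A)) : ℕ :=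
  sInf {e | ∃ I : Finset (Fin d), IsDistinguisher P I ∧ I.card = e}

/-- A `d`-dimensional template is simple if for every `m < d` there are
`x, y ∈ P` with `x i = y i` exactly when `i ≠ m`. -/
def IsSimple {d : ℕ} {A : Type} (P : Set (Fin d → A)) : Prop :=
  ∀ m : Fin d, ∃ x ∈ P, ∃ y ∈ P, ∀ i, (x i = y i ↔ i ≠ m)

/-- The edges of the zero hypergraph of a `(k, n)`-ary real polynomial:
`k`-element subsets `{a_0, …, a_{k-1}}` of `ℝⁿ` with `p(a_0, …, a_{k-1}) = 0`
for some ordering of the elements. -/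
def zeroEdges {n k : ℕ} (p : MvPolynomial (Fin k × Fin n) ℝ) :
    Set (Set (Fin n → ℝ)) :=
  {A | ∃ a : Fin k → (Fin n → ℝ), Function.Injective a ∧ A = Set.range a ∧
        MvPolynomial.eval (fun q => a q.1 q.2) p = 0}

/-- `H₂ = (V₂, E₂)` contains (a copy of) `H₁ = (V₁, E₁)`: some injection
`V₁ → V₂` maps every edge of `H₁` onto an edge of `H₂`. -/
def HGContains {V₁ V₂ : Type} (E₁ : Set (Set V₁)) (E₂ : Set (Set V₂)) : Prop :=
  ∃ f : V₁ → V₂, Function.Injective f ∧ ∀ e ∈ E₁, f '' e ∈ E₂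

theorem cardSucc_succ (κ : Cardinal) (m : ℕ) :
    cardSucc κ (m + 1) = Order.succ (cardSucc κ m) :=
  Function.iterate_succ_apply' _ _ _

theorem le_cardSucc (κ : Cardinal) (m : ℕ) : κ ≤ cardSucc κ m := by
  induction m with
  | zero => exact le_rfl
  | succ m ih => rw [cardSucc_succ]; exact ih.trans (Order.le_succ _)

theorem cardSucc_lt_aleph0 {κ : Cardinal} (hκ : κ < ℵ₀) (m : ℕ) : cardSucc κ m < ℵ₀ := by
  induction m with
  | zero => exact hκ
  | succ m ih => rw [cardSucc_succ]; exact isSuccLimit_aleph0.succ_lt ih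

/-- If `X` has cardinality at most `κ^{+n}`, then `X^{n+1}` can be coloured with `κ` colours and
each point assigned a direction so that two points with the same colour and the same direction `i`
never lie on a common line parallel to the `i`-th axis. -/
theorem exists_coloring_direction {C : Type} (hC : ℵ₀ ≤ #C) (n : ℕ) (X : Type)
    (hX : #X ≤ cardSucc #C n) :
    ∃ (φ : (Fin (n + 1) → X) → C) (D : (Fin (n + 1) → X) → Fin (n + 1)),
      ∀ p q, φ p = φ q → D p = D q → (∀ i ≠ D p, p i = q i) → p = q := by
  induction n generalizing X with
  | zero =>
    obtain ⟨g⟩ : Nonempty (X ↪ C) := hX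
    refine ⟨fun p => g (p 0), fun _ => 0, fun p q h _ _ => funext fun i => ?_⟩
    rw [Fin.fin_one_eq_zero i]
    exact g.injective h
  | succ n ih =>
    rw [cardSucc_succ] at hX
    set μ := cardSucc #C n
    have hμ : ℵ₀ ≤ μ := hC.trans (le_cardSucc _ _)
    obtain ⟨e⟩ : Nonempty (X ↪ (Order.succ μ).ord.ToType) := by
      rw [← mk_ord_toType (Order.succ μ)] at hX
      exact hX
    have hseg (y : (Order.succ μ).ord.ToType) : #{x : X // e x ≤ y} ≤ μ := by
      have hle : #(Set.Iic y) ≤ μ := Order.lt_succ_iff.1 <| by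
        simpa using mk_Iic_lt y (by simp) (by simpa using hμ.trans (Order.le_succ μ))
      refine le_trans (mk_le_of_injective (f := fun x : {x : X // e x ≤ y} =>
        (⟨e x.1, x.2⟩ : Set.Iic y)) fun a b hab => ?_) hle
      exact Subtype.ext (e.injective (congrArg Subtype.val hab))
    choose φ D hφ using fun y => ih {x : X // e x ≤ y} (hseg y)
    choose j hj using fun p : Fin (n + 2) → X => Finite.exists_max fun i => e (p i)
    obtain ⟨ι⟩ : Nonempty (Fin (n + 2) × C ↪ C) := by
      change #(Fin (n + 2) × C) ≤ #C
      rw [mk_prod, lift_id, lift_id, mk_fin]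
      exact mul_le_of_le hC (natCast_lt_aleph0.le.trans hC) le_rfl
    let rest (p : Fin (n + 2) → X) : Fin (n + 1) → {x : X // e x ≤ e (p (j p))} :=
      fun i => ⟨p ((j p).succAbove i), hj p _⟩
    refine ⟨fun p => ι (j p, φ _ (rest p)), fun p => (j p).succAbove (D _ (rest p)), ?_⟩
    intro p q hc hd hpq
    obtain ⟨hj', hc'⟩ := Prod.mk.inj (ι.injective hc)
    have hmax : p (j p) = q (j p) := hpq _ (Fin.succAbove_ne _ _).symm
    have key (a : Fin (n + 2)) (y) (u v : Fin (n + 1) → {x : X // e x ≤ y})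
        (hu : ∀ i, (u i).1 = p (a.succAbove i)) (hv : ∀ i, (v i).1 = q (a.succAbove i))
        (huv : φ y u = φ y v) (hD : a.succAbove (D y u) = a.succAbove (D y v))
        (hoff : ∀ i ≠ a.succAbove (D y u), p i = q i) (ha : p a = q a) : p = q := by
      have := hφ y u v huv (Fin.succAbove_right_injective hD) fun i hi => by
        apply Subtype.ext
        rw [hu, hv]
        exact hoff _ fun h => hi (Fin.succAbove_right_injective h)
      funext i
      rcases eq_or_ne i a with rfl | hi
      · exact ha
      · obtain ⟨i, rfl⟩ := Fin.exists_succAbove_eq hi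
        rw [← hu, ← hv, this]
    have hy : e (q (j q)) = e (p (j p)) := by rw [← hj', hmax]
    have tr : ∀ y, e (q (j q)) = y → ∃ v : Fin (n + 1) → {x : X // e x ≤ y},
        (∀ i, (v i).1 = q ((j q).succAbove i)) ∧ φ y v = φ _ (rest q) ∧
          D y v = D _ (rest q) := by
      rintro _ rfl
      exact ⟨rest q, fun _ => rfl, rfl, rfl⟩
    obtain ⟨v, hv, hv₁, hv₂⟩ := tr _ hy
    refine key (j p) _ (rest p) v (fun _ => rfl) (fun i => ?_) (hc'.trans hv₁.symm) ?_ hpq hmax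
    · rw [hv, hj']
    · rw [hv₂]
      simpa [← hj'] using hd

/-- Every colouring of `X^n` by `C`, where `X` has at least `μ` elements, has a monochromatic
`k × ⋯ × k` grid. -/
def HasGrids (k : ℕ) (C : Type) (n : ℕ) (μ : Cardinal) : Prop :=
  ∀ X : Type, μ ≤ #X → ∀ f : (Fin n → X) → C,
    ∃ A : Fin n → Finset X, (∀ i, (A i).card = k) ∧ ∃ c, ∀ x, (∀ i, x i ∈ A i) → f x = c

theorem hasGrids_zero (k : ℕ) (C : Type) (μ : Cardinal) : HasGrids k C 0 μ := fun _ _ f =>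
  ⟨Fin.elim0, fun i => i.elim0, f Fin.elim0, fun _ _ => congrArg f (Subsingleton.elim _ _)⟩

theorem exists_finset_constant {X G : Type} {k : ℕ} (h : #G * k < #X) (g : X → G) :
    ∃ s : Finset X, s.card = k ∧ ∃ a, ∀ x ∈ s, g x = a := by
  by_contra! hcon
  have hsmall (a : G) : #(g ⁻¹' {a}) ≤ k := by
    by_contra! hlt
    obtain ⟨s, hs⟩ := exists_finset_le_card _ _ hlt.le
    obtain ⟨t, -, ht⟩ := Finset.exists_subset_card_eq hs
    obtain ⟨x, hx, hxa⟩ := hcon (t.map (Function.Embedding.subtype _)) (by simpa using ht) a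
    obtain ⟨y, -, rfl⟩ := Finset.mem_map.1 hx
    exact hxa y.2
  refine h.not_ge ?_
  rw [← mk_congr (Equiv.sigmaFiberEquiv g), mk_sigma]
  refine (sum_le_sum _ (fun _ => (k : Cardinal)) hsmall).trans ?_
  simp

theorem HasGrids.succ {k : ℕ} {C : Type} {n : ℕ} {Y : Type} {ν : Cardinal} (hk : k ≠ 0)
    (h : HasGrids k C n #Y) (hν : #((Fin n → Finset Y) × C) * k < ν) (hY : #Y ≤ ν) :
    HasGrids k C (n + 1) ν := by
  intro X hX f
  obtain ⟨ι⟩ : Nonempty (Y ↪ X) := hY.trans hX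
  choose A hA c hc using fun x => h Y le_rfl fun v => f (Fin.cons x (ι ∘ v))
  obtain ⟨s, hs, ⟨B, b⟩, hsB⟩ := exists_finset_constant (hν.trans_le hX) fun x => (A x, c x)
  have hsB' (x) (hx : x ∈ s) : A x = B ∧ c x = b := Prod.mk.inj (hsB x hx)
  refine ⟨Fin.cons s fun i => (B i).map ι, ?_, b, ?_⟩
  · intro i
    refine Fin.cases (by simpa using hs) (fun i => ?_) i
    obtain ⟨x, hx⟩ := Finset.card_ne_zero.1 (hs.trans_ne hk)
    simp [← (hsB' x hx).1, hA]
  · intro x hx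
    have h0 : x 0 ∈ s := by simpa using hx 0
    have hx' (i : Fin n) : ∃ y ∈ B i, ι y = x i.succ := by simpa using hx i.succ
    choose v hv hvx using hx'
    rw [← (hsB' _ h0).2, ← hc (x 0) v fun i => by rw [(hsB' _ h0).1]; exact hv i]
    congr 1
    funext i
    refine Fin.cases rfl (fun i => ?_) i
    simp [hvx]

theorem hasGrids_of_infinite {k : ℕ} (hk : k ≠ 0) {C : Type} (hC : ℵ₀ ≤ #C) (n : ℕ) :
    HasGrids k C n (cardSucc #C n) := by
  induction n with
  | zero => exact hasGrids_zero _ _ _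
  | succ n ih =>
    rw [cardSucc_succ]
    set μ := cardSucc #C n with hμ
    have hCμ : #C ≤ μ := le_cardSucc _ _
    have hμ0 : ℵ₀ ≤ μ := hC.trans hCμ
    have hY : #μ.out = μ := mk_out μ
    rw [← hY] at ih
    refine ih.succ hk (Order.lt_succ_iff.2 ?_) (hY.trans_le (Order.le_succ _))
    have : Infinite μ.out := by rwa [infinite_iff, hY]
    have hpow : #(Fin n → Finset μ.out) ≤ μ := by
      simpa [hY] using power_nat_le (n := n) hμ0
    rw [mk_prod, lift_id, lift_id]
    exact mul_le_of_le hμ0 (mul_le_of_le hμ0 hpow hCμ) (natCast_lt_aleph0.le.trans hμ0)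

theorem hasGrids_of_finite {k : ℕ} (hk : k ≠ 0) (C : Type) [Finite C] (n : ℕ) :
    ∃ N : ℕ, HasGrids k C n N := by
  induction n with
  | zero => exact ⟨0, hasGrids_zero _ _ _⟩
  | succ n ih =>
    obtain ⟨N, hN⟩ := ih
    obtain ⟨M, hM⟩ := lt_aleph0.1 (mul_lt_aleph0
      (mk_lt_aleph0_iff.2 (inferInstance : Finite ((Fin n → Finset (Fin N)) × C)))
      (natCast_lt_aleph0 (n := k)))
    rw [← mk_fin N] at hN
    refine ⟨M + 1 + N, hN.succ hk ?_ ?_⟩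
    · rw [hM]; exact_mod_cast (by omega : M < M + 1 + N)
    · rw [mk_fin]; exact_mod_cast (by omega : N ≤ M + 1 + N)

/-- If `κ^{+n} < 2^ℵ₀`, then every colouring of `ℝ^{n+1}` by `κ` colours has a monochromatic
`k × ⋯ × k` grid. -/
theorem exists_real_grid {k : ℕ} (hk : k ≠ 0) (C : Type) (n : ℕ)
    (h : cardSucc #C n < 𝔠) (f : (Fin (n + 1) → ℝ) → C) :
    ∃ A : Fin (n + 1) → Finset ℝ,
      (∀ i, (A i).card = k) ∧ ∃ c, ∀ x, (∀ i, x i ∈ A i) → f x = c := by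
  rcases finite_or_infinite C with hC | hC
  · obtain ⟨N, hN⟩ := hasGrids_of_finite hk C (n + 1)
    exact hN ℝ (by rw [mk_real]; exact natCast_lt_aleph0.le.trans aleph0_le_continuum) f
  · refine hasGrids_of_infinite hk (infinite_iff.1 hC) (n + 1) ℝ ?_ f
    rw [mk_real, cardSucc_succ]
    exact Order.succ_le_of_lt h

theorem exists_ne_agree_of_card_eq_eDim {d : ℕ} {A : Type} {P : Set (Fin d → A)}
    {I : Finset (Fin d)} (hI : I.card = eDim P) {i : Fin d} (hi : i ∈ I) :
    ∃ x ∈ P, ∃ y ∈ P, x ≠ y ∧ ∀ j ∈ I, j ≠ i → x j = y j := by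
  by_contra! hcon
  have hdist : IsDistinguisher P (I.erase i) := fun x hx y hy hxy => by
    obtain ⟨j, hj, hji, hne⟩ := hcon x hx y hy hxy
    exact ⟨j, Finset.mem_erase.2 ⟨hji, hj⟩, hne⟩
  have hle : eDim P ≤ (I.erase i).card := Nat.sInf_le ⟨_, hdist, rfl⟩
  exact (hI ▸ hle).not_gt (Finset.card_erase_lt_of_mem hi)

/-- A set `Q` of `k` points, any two of which differ on `I`, has a homomorphic
image with `k` elements inside every set `{v | ∀ i ∈ I, v i ∈ A i, ∀ i ∉ I, v i = 0}` with all
`A i` of size `k`. -/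
theorem exists_edge_subset_grid {d k : ℕ} {Q : Set (Fin d → ℝ)} (hQ : Q.Finite)
    (hQk : Q.ncard = k) {I : Finset (Fin d)} (hI : IsDistinguisher Q I)
    (A : Fin d → Finset ℝ)
    (hA : ∀ i ∈ I, (A i).card = k) :
    ∃ E ∈ templateEdges k (B := fun _ : Fin d => ℝ) Q,
      ∀ v ∈ E, (∀ i ∈ I, v i ∈ A i) ∧ ∀ i ∉ I, v i = 0 := by
  classical
  have hg (i : Fin d) : ∃ g : ℝ → ℝ, i ∈ I →
      (∀ x ∈ Q, g (x i) ∈ A i) ∧ Set.InjOn g ((fun x => x i) '' Q) := by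
    by_cases hi : i ∈ I
    · have hle : ((fun x : Fin d → ℝ => x i) '' Q).ncard ≤ (A i : Set ℝ).ncard := by
        rw [Set.ncard_coe_finset, hA i hi, ← hQk]
        exact Set.ncard_image_le hQ
      rw [← ENat.natCast_le_natCast, (hQ.image _).cast_ncard_eq,
        (A i).finite_toSet.cast_ncard_eq] at hle
      obtain ⟨g, hgA, hginj⟩ := (hQ.image _).exists_injOn_of_encard_le hle
      exact ⟨g, fun _ => ⟨fun x hx => hgA ⟨x, hx, rfl⟩, hginj⟩⟩
    · exact ⟨id, fun h => absurd h hi⟩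
  choose g hg using hg
  let F : (Fin d → ℝ) → Fin d → ℝ := fun x i => if i ∈ I then g i (x i) else 0
  have hF : Set.InjOn F Q := fun x hx y hy hxy => by
    by_contra hne
    obtain ⟨i, hi, hxi⟩ := hI x hx y hy hne
    have := congrFun hxy i
    simp only [F, if_pos hi] at this
    exact hxi ((hg i hi).2 ⟨x, hx, rfl⟩ ⟨y, hy, rfl⟩ this)
  refine ⟨F '' Q, ⟨(hF.ncard_image).trans hQk, F, Set.mapsTo_image F Q,
    Set.surjOn_image F Q, fun x _ y _ i hxy => ?_⟩, ?_⟩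
  · simp only [F, hxy]
  · rintro _ ⟨x, hx, rfl⟩
    exact ⟨fun i hi => by simpa only [F, if_pos hi] using (hg i hi).1 x hx,
      fun i hi => by simp only [F, if_neg hi]⟩

/-- If `Q` is a set of `k` points vanishing off the distinguisher `I`, and for each `i ∈ I` some two
points of `Q` differ exactly at `i`, then `L(ℝ^d, Q)` is `κ`-colourable if and only if
`2^ℵ₀ ≤ κ^{+(|I|-1)}`. -/
theorem hgColorable_templateEdges_iff {d k n : ℕ} (hk : k ≠ 0) {Q : Set (Fin d → ℝ)}
    (hQ : Q.Finite) (hQk : Q.ncard = k) {I : Finset (Fin d)} (hI : IsDistinguisher Q I)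
    (hoff : ∀ x ∈ Q, ∀ i ∉ I, x i = 0) (hn : I.card = n + 1)
    (hmin : ∀ i ∈ I, ∃ x ∈ Q, ∃ y ∈ Q, x ≠ y ∧ ∀ j ≠ i, x j = y j) (κ : Cardinal) :
    HGColorable (templateEdges k (B := fun _ : Fin d => ℝ) Q) κ ↔ 𝔠 ≤ cardSucc κ n := by
  classical
  let σ : I ≃ Fin (n + 1) := I.equivFinOfCardEq hn
  constructor
  · rintro ⟨C, φ, hC, hφ⟩
    by_contra! hlt
    have hlt' : cardSucc #C n < 𝔠 :=
      ((Order.succ_mono (α := Cardinal)).iterate n hC).trans_lt hlt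
    let ext (v : Fin (n + 1) → ℝ) : Fin d → ℝ := fun i => if h : i ∈ I then v (σ ⟨i, h⟩) else 0
    obtain ⟨A, hA, c, hc⟩ := exists_real_grid hk C n hlt' fun v => φ (ext v)
    obtain ⟨E, hE, hEA⟩ := exists_edge_subset_grid hQ hQk hI
      (fun i => if h : i ∈ I then A (σ ⟨i, h⟩) else ∅) fun i hi => by
        simpa only [dif_pos hi] using hA _
    have hconst (v) (hv : v ∈ E) : φ v = c := by
      obtain ⟨hv₁, hv₂⟩ := hEA v hv
      rw [← hc fun i => v (σ.symm i)]
      · congr 1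
        funext i
        by_cases hi : i ∈ I
        · simp [ext, hi]
        · simp [ext, hi, hv₂ i hi]
      · intro i
        simpa using hv₁ (σ.symm i) (σ.symm i).2
    obtain ⟨x, hx, y, hy, hxy⟩ := hφ E hE
    exact hxy ((hconst x hx).trans (hconst y hy).symm)
  · intro hκ
    have hκ0 : ℵ₀ ≤ κ := by
      by_contra! hlt
      exact (hκ.trans_lt (cardSucc_lt_aleph0 hlt n)).not_ge aleph0_le_continuum
    have hout : #κ.out = κ := mk_out κ
    obtain ⟨φ, D, hφ⟩ := exists_coloring_direction (C := κ.out) (by rwa [hout]) n ℝ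
      (by rwa [hout, mk_real])
    let res (v : Fin d → ℝ) : Fin (n + 1) → ℝ := fun i => v (σ.symm i)
    refine ⟨κ.out × Fin (n + 1), fun v => (φ (res v), D (res v)), ?_, ?_⟩
    · rw [mk_prod, lift_id, lift_id, hout, mk_fin]
      exact mul_le_of_le hκ0 le_rfl (natCast_lt_aleph0.le.trans hκ0)
    rintro E ⟨hEk, f, hfE, hfsurj, hf⟩
    by_contra! hconst
    have hEimg : f '' Q = E := hfsurj.image_eq_of_mapsTo hfE
    have hfinj : Set.InjOn f Q :=
      Set.injOn_of_ncard_image_eq (by rw [hEimg, hEk, hQk]) hQ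
    obtain ⟨z, hz⟩ : Q.Nonempty := Set.nonempty_of_ncard_ne_zero (hQk.trans_ne hk)
    set i := σ.symm (D (res (f z)))
    obtain ⟨x, hx, y, hy, hxy, hagree⟩ := hmin i i.2
    have hcol := hconst _ (hfE hx) _ (hfE hy)
    have hcolz := hconst _ (hfE hx) _ (hfE hz)
    have hres : res (f x) = res (f y) := by
      refine hφ _ _ (congrArg Prod.fst hcol) (congrArg Prod.snd hcol) fun j hj => ?_
      refine hf x hx y hy _ (hagree _ fun h => hj ?_)
      have hD : D (res (f x)) = D (res (f z)) := congrArg Prod.snd hcolz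
      rw [hD]
      exact σ.symm.injective (Subtype.ext h)
    refine hxy (hfinj hx hy (funext fun j => ?_))
    by_cases hj : j ∈ I
    · obtain ⟨m, hm⟩ := σ.symm.surjective ⟨j, hj⟩
      obtain rfl : (σ.symm m : Fin d) = j := congrArg Subtype.val hm
      exact congrFun hres m
    · exact hf x hx y hy j ((hoff x hx j hj).trans (hoff y hy j hj).symm)

/-- Corollary 1.5(b): if `I` is a distinguisher for `P` of
cardinality `e(P)` and `Q` is obtained from `P` by keeping the coordinates in
`I` and zeroing out the others, then `χ(L(ℝ^d, Q))` is the least cardinal `κ`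
with `κ^{+(e(P)-1)} ≥ 2^{ℵ₀}`. -/
theorem statement12 (d k : ℕ) (hd : 1 ≤ d) (hk : 2 ≤ k)
    (P : Set (Fin d → ℝ)) (hP : P.ncard = k)
    (I : Finset (Fin d)) (hI : IsDistinguisher P I) (hIcard : I.card = eDim P)
    (Q : Set (Fin d → ℝ))
    (hQ : Q = {x | (∃ y ∈ P, ∀ i ∈ I, x i = y i) ∧ ∀ i ∉ I, x i = 0}) :
    chrNum (templateEdges k (B := fun _ : Fin d => ℝ) Q) =
      sInf {κ : Cardinal | Cardinal.continuum ≤ cardSucc κ (eDim P - 1)} := by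
  classical
  have hk0 : k ≠ 0 := by omega
  have hPfin : P.Finite := Set.finite_of_ncard_ne_zero (hP.trans_ne hk0)
  let π (y : Fin d → ℝ) : Fin d → ℝ := fun i => if i ∈ I then y i else 0
  have hπ (y i) (hi : i ∈ I) : π y i = y i := if_pos hi
  have hπ0 (y i) (hi : i ∉ I) : π y i = 0 := if_neg hi
  have hQπ : Q = π '' P := by
    rw [hQ]
    ext x
    constructor
    · rintro ⟨⟨y, hy, hxy⟩, hx⟩
      refine ⟨y, hy, funext fun i => ?_⟩
      by_cases hi : i ∈ I
      · rw [hπ y i hi, hxy i hi]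
      · rw [hπ0 y i hi, hx i hi]
    · rintro ⟨y, hy, rfl⟩
      exact ⟨⟨y, hy, hπ y⟩, hπ0 y⟩
  have hne (x) (hx : x ∈ P) (y) (hy : y ∈ P) (hxy : x ≠ y) : ∃ i ∈ I, π x i ≠ π y i := by
    obtain ⟨i, hi, h⟩ := hI x hx y hy hxy
    exact ⟨i, hi, by rwa [hπ _ _ hi, hπ _ _ hi]⟩
  have hinj : Set.InjOn π P := fun x hx y hy hxy => by
    by_contra h
    obtain ⟨i, -, hi⟩ := hne x hx y hy h
    exact hi (congrFun hxy i)
  have hQk : Q.ncard = k := by rw [hQπ, hinj.ncard_image, hP]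
  obtain ⟨n, hn⟩ : ∃ n, I.card = n + 1 := by
    obtain ⟨x, y, hx, hy, hxy⟩ := (Set.one_lt_ncard_iff hPfin).1 (by omega : 1 < P.ncard)
    obtain ⟨i, hi, -⟩ := hI x hx y hy hxy
    exact Nat.exists_eq_succ_of_ne_zero (Finset.card_ne_zero_of_mem hi)
  rw [← hIcard, hn, Nat.add_sub_cancel, chrNum]
  congr 1
  ext κ
  refine hgColorable_templateEdges_iff hk0 (hQπ ▸ hPfin.image π) hQk (I := I) ?_ ?_ hn ?_ κ
  · rw [hQπ]
    rintro _ ⟨x, hx, rfl⟩ _ ⟨y, hy, rfl⟩ hxy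
    exact hne x hx y hy fun h => hxy (congrArg π h)
  · rw [hQπ]
    rintro _ ⟨x, -, rfl⟩
    exact hπ0 x
  · intro i hi
    obtain ⟨x, hx, y, hy, hxy, hagree⟩ := exists_ne_agree_of_card_eq_eDim hIcard hi
    rw [hQπ]
    refine ⟨π x, ⟨x, hx, rfl⟩, π y, ⟨y, hy, rfl⟩, fun h => hxy (hinj hx hy h), fun j hj => ?_⟩
    by_cases hjI : j ∈ I
    · rw [hπ _ _ hjI, hπ _ _ hjI, hagree j hjI hj]
    · rw [hπ0 _ _ hjI, hπ0 _ _ hjI]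
end

section
/- Suppose 2 ≤ k < ω and κ is a cardinal with κ ≤ 2^{ℵ₀} ≤ κ^{+(k−2)}. Then there exist d ≥ 1 and a d-dimensional k-template P of d-tuples of reals such that χ(L(ℝ^d,P)) = κ. -/
open Cardinal

/-- Every `C`-coloring of `X ^ d` has a monochromatic corner with `n + 1` points on each of its
`d` axes: `fun i => F i 0` is the apex and `F i` lists the points on the `i`-th axis. -/
def HasCorner (n d : ℕ) (X C : Type) : Prop :=
  ∀ f : (Fin d → X) → C, ∃ F : Fin d → Fin (n + 1) → X, (∀ i, Function.Injective (F i)) ∧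
    ∀ i j, f (Function.update (fun i => F i 0) i (F i j)) = f (fun i => F i 0)

theorem HasCorner.zero (n : ℕ) (X C : Type) : HasCorner n 0 X C := fun _ =>
  ⟨fun i => i.elim0, fun i => i.elim0, fun i => i.elim0⟩

theorem HasCorner.of_injective {n d : ℕ} {X Y C : Type} (h : HasCorner n d Y C) (ι : Y → X)
    (hι : Function.Injective ι) : HasCorner n d X C := by
  intro f
  obtain ⟨F, hF, hf⟩ := h fun c => f (ι ∘ c)
  refine ⟨fun i j => ι (F i j), fun i => hι.comp (hF i), fun i j => ?_⟩
  have := hf i j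
  rw [Function.comp_update] at this
  exact this

theorem HasCorner.succ {n d : ℕ} {X Y C : Type} (h : HasCorner n d Y C) (ι : Y → X)
    (hι : Function.Injective ι) (hX : #(C × (Fin d → Fin (n + 1) → Y)) * n < #X) :
    HasCorner n (d + 1) X C := by
  intro f
  choose F hF hf using fun x : X => h fun c => f (Fin.cons x (ι ∘ c))
  let T : X → C × (Fin d → Fin (n + 1) → Y) := fun x =>
    (f (Fin.cons x (ι ∘ fun i => F x i 0)), F x)
  obtain ⟨⟨c, G⟩, hcG⟩ : ∃ t, (n : Cardinal) < #(T ⁻¹' {t}) := by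
    by_contra! hcon
    exact hX.not_ge (mk_le_mk_mul_of_mk_preimage_le T hcon)
  obtain ⟨e⟩ : Nonempty (Fin (n + 1) ↪ T ⁻¹' {(c, G)}) := by
    rw [← Cardinal.le_def, mk_fin, Nat.cast_succ, ← Cardinal.succ_natCast]
    exact Order.succ_le_of_lt hcG
  have he : ∀ j, f (Fin.cons (e j : X) (ι ∘ fun i => G i 0)) = c ∧ F (e j) = G := by
    intro j
    have := (e j).2
    simp only [Set.mem_preimage, Set.mem_singleton_iff, T, Prod.mk.injEq] at this
    obtain ⟨h1, h2⟩ := this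
    rw [h2] at h1
    exact ⟨h1, h2⟩
  have hapex : (fun i => (Fin.cons (fun j => (e j : X)) (fun i j => ι (G i j)) :
      Fin (d + 1) → Fin (n + 1) → X) i 0) = Fin.cons (e 0 : X) (ι ∘ fun i => G i 0) := by
    ext i
    refine Fin.cases ?_ (fun i => ?_) i <;> simp
  refine ⟨Fin.cons (fun j => (e j : X)) (fun i j => ι (G i j)), fun i => ?_, fun i j => ?_⟩
  · refine Fin.cases ?_ (fun i => ?_) i
    · exact Subtype.val_injective.comp e.injective
    · have hG := hF (e 0) i
      rw [(he 0).2] at hG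
      exact hι.comp hG
  · rw [hapex]
    refine Fin.cases ?_ (fun i => ?_) i
    · simp only [Fin.cons_zero, Fin.update_cons_zero]
      rw [(he j).1, (he 0).1]
    · have hG := hf (e 0) i j
      rw [(he 0).2, Function.comp_update] at hG
      simpa only [Fin.cons_succ, ← Fin.cons_update] using hG

theorem cardSucc_succ_left (κ : Cardinal) (m : ℕ) :
    cardSucc κ (m + 1) = cardSucc (Order.succ κ) m :=
  Function.iterate_succ_apply _ _ _

theorem cardSucc_mono (m : ℕ) : Monotone fun κ => cardSucc κ m :=
  Order.succ_mono.iterate m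

theorem hasCorner_of_aleph0_le {n : ℕ} {C : Type} {κ : Cardinal} (hκ : ℵ₀ ≤ κ) (hC : #C ≤ κ)
    (d : ℕ) (X : Type) (hX : cardSucc κ d ≤ #X) : HasCorner n d X C := by
  induction d generalizing X with
  | zero => exact .zero n X C
  | succ d ih =>
    rw [cardSucc_succ, Order.succ_le_iff] at hX
    have hinf : ℵ₀ ≤ cardSucc κ d := hκ.trans (le_cardSucc κ d)
    have hpow : ∀ (m : ℕ) {μ : Cardinal}, μ ≤ cardSucc κ d → μ ^ m ≤ cardSucc κ d :=
      fun m μ hμ => (pow_le_pow_left' hμ m).trans (power_nat_le hinf)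
    obtain ⟨ι⟩ : Nonempty ((cardSucc κ d).out ↪ X) := by
      rw [← Cardinal.le_def, mk_out]
      exact hX.le
    refine (ih _ (mk_out _).ge).succ ι ι.injective (lt_of_le_of_lt ?_ hX)
    refine (mul_le_mul' (?_ : _ ≤ cardSucc κ d)
      ((natCast_lt_aleph0 (n := n)).le.trans hinf)).trans (mul_eq_self hinf).le
    simp only [mk_prod, lift_id, mk_pi, prod_const, mk_fin, mk_out]
    refine (mul_le_mul' (hC.trans (le_cardSucc κ d)) ?_).trans (mul_eq_self hinf).le
    simp only [Cardinal.power_natCast]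
    exact hpow _ (hpow _ le_rfl)

theorem exists_finite_hasCorner (n : ℕ) (C : Type) [Finite C] (d : ℕ) :
    ∃ X : Type, Finite X ∧ HasCorner n d X C := by
  induction d with
  | zero => exact ⟨Unit, inferInstance, .zero n Unit C⟩
  | succ d ih =>
    obtain ⟨Y, hY, h⟩ := ih
    refine ⟨Fin (Nat.card (C × (Fin d → Fin (n + 1) → Y)) * n + 1) ⊕ Y, inferInstance,
      h.succ Sum.inr Sum.inr_injective ?_⟩
    rw [← Nat.cast_card, ← Nat.cast_card (α := _ ⊕ Y)]
    norm_cast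
    rw [Nat.card_sum, Nat.card_fin]
    omega

/-- `K` colors suffice to color `X ^ d` so that every point is the only one of its color on some
axis-parallel line through it. -/
def HasLineColoring (d : ℕ) (X K : Type) : Prop :=
  ∃ g : (Fin d → X) → K, ∀ a, ∃ i, ∀ b, (∀ j, j ≠ i → b j = a j) → g b = g a → b = a

theorem hasLineColoring_of_le {K : Type} (hK : ℵ₀ ≤ #K) (d : ℕ) (X : Type)
    (hX : #X ≤ cardSucc #K d) : HasLineColoring (d + 1) X K := by
  induction d generalizing X with
  | zero =>
    obtain ⟨e⟩ : Nonempty (X ↪ K) := hX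
    refine ⟨fun a => e (a 0), fun a => ⟨0, fun b _ hb => ?_⟩⟩
    ext j
    rw [Fin.fin_one_eq_zero j]
    exact e.injective hb
  | succ d ih =>
    obtain ⟨g, hg⟩ := ih (cardSucc #K d).out (mk_out _).le
    have hinf : ℵ₀ ≤ cardSucc #K d := hK.trans (le_cardSucc _ d)
    rw [cardSucc_succ] at hX
    let Y := (Order.succ (cardSucc #K d)).ord.ToType
    obtain ⟨ι⟩ : Nonempty (X ↪ Y) := by
      rw [← Cardinal.le_def, mk_ord_toType]
      exact hX
    have hr : ∀ x : Y, ∃ r : Y → (cardSucc #K d).out, Set.InjOn r (Set.Iic x) := by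
      intro x
      have hne : Nonempty (cardSucc #K d).out := by
        rw [← mk_ne_zero_iff, mk_out]
        exact (aleph0_pos.trans_le hinf).ne'
      have hIio : #(Set.Iio x) ≤ cardSucc #K d :=
        Order.lt_succ_iff.1 ((mk_Iio_lt x (by simp [Y])).trans_eq (mk_ord_toType _))
      have hIic : #(Set.Iic x) ≤ #(cardSucc #K d).out := by
        rw [mk_out, ← Set.Iio_insert]
        exact (mk_insert_le).trans (add_le_of_le hinf hIio (one_le_aleph0.trans hinf))
      obtain ⟨e⟩ := hIic
      classical
      refine ⟨fun y => if h : y ≤ x then e ⟨y, h⟩ else Classical.arbitrary _, ?_⟩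
      intro y hy z hz hyz
      rw [Set.mem_Iic] at hy hz
      simp only [hy, hz, dite_true] at hyz
      exact congrArg Subtype.val (e.injective hyz)
    choose r hr using hr
    choose M hM using fun a : Fin (d + 2) → X => Finite.exists_max fun i => ι (a i)
    obtain ⟨p⟩ : Nonempty (Fin (d + 2) × K ↪ K) := by
      rw [← Cardinal.le_def, mk_prod, lift_id, lift_id, mk_fin]
      exact (mul_le_mul_left (natCast_lt_aleph0.le.trans hK) _).trans (mul_eq_self hK).le
    refine ⟨fun a => p (M a, g fun j => r (ι (a (M a))) (ι (a ((M a).succAbove j)))),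
      fun a => ?_⟩
    obtain ⟨i, hi⟩ := hg fun j => r (ι (a (M a))) (ι (a ((M a).succAbove j)))
    refine ⟨(M a).succAbove i, fun b hb hab => ?_⟩
    have hab := p.injective hab
    simp only [Prod.mk.injEq] at hab
    obtain ⟨hMb, hgb⟩ := hab
    have hbM : b (M a) = a (M a) := hb _ (Fin.succAbove_ne _ _).symm
    rw [hMb, hbM] at hgb
    have hba := hi _ (fun j hj =>
      congrArg (fun y => r _ (ι y)) (hb _ fun h => hj (Fin.succAbove_right_injective h))) hgb
    ext j
    rcases Fin.eq_self_or_eq_succAbove (M a) j with rfl | ⟨j, rfl⟩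
    · exact hbM
    · refine ι.injective (hr (ι (a (M a))) ?_ (hM a _) (congrFun hba j))
      have := hM b ((M a).succAbove j)
      rwa [hMb, hbM] at this

/-- Coordinates of the points of the corner template: the `j`-th point lies on the axis `dir j`,
at position `j`. -/
def cornerIndex {k d : ℕ} (dir : Fin (k + 1) → Fin d) (j : Fin (k + 1)) (i : Fin d) :
    Fin (k + 1) :=
  if i = dir j then j else 0

theorem cornerIndex_injective {k d : ℕ} (dir : Fin (k + 1) → Fin d) :
    Function.Injective (cornerIndex dir) := by
  intro j j' h
  have h1 := congrFun h (dir j)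
  have h2 := congrFun h (dir j')
  simp only [cornerIndex] at h1 h2
  grind

/-- The corner template with `k + 1` points in `ℝ ^ d`. -/
def cornerTemplate {k d : ℕ} (dir : Fin (k + 1) → Fin d) : Set (Fin d → ℝ) :=
  Set.range fun j i => ((cornerIndex dir j i : ℕ) : ℝ)

theorem cornerPoint_injective {k d : ℕ} (dir : Fin (k + 1) → Fin d) :
    Function.Injective fun j (i : Fin d) => ((cornerIndex dir j i : ℕ) : ℝ) := by
  intro j j' h
  refine cornerIndex_injective dir (funext fun i => Fin.ext ?_)
  exact Nat.cast_injective (congrFun h i)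

theorem ncard_range_of_injective {k : ℕ} {V : Type} {q : Fin k → V} (hq : Function.Injective q) :
    (Set.range q).ncard = k := by
  rw [← Nat.card_coe_set_eq, Nat.card_range_of_injective hq, Nat.card_fin]

theorem not_hgColorable_cornerTemplate {k d : ℕ} (dir : Fin (k + 1) → Fin d) {μ : Cardinal}
    (h : ∀ C : Type, #C ≤ μ → HasCorner k d ℝ C) :
    ¬ HGColorable (templateEdges (k + 1) (B := fun _ : Fin d => ℝ) (cornerTemplate dir)) μ := by
  rintro ⟨C, φ, hC, hφ⟩
  obtain ⟨F, hF, hmono⟩ := h C hC φ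
  let q : Fin (k + 1) → Fin d → ℝ := fun j i => F i (cornerIndex dir j i)
  have hq : Function.Injective q := fun j j' hj =>
    cornerIndex_injective dir (funext fun i => hF i (congrFun hj i))
  have hcol : ∀ j, φ (q j) = φ fun i => F i 0 := by
    intro j
    rw [← hmono (dir j) j]
    congr 1
    ext i
    by_cases hi : i = dir j
    · subst hi
      simp [q, cornerIndex]
    · simp [q, cornerIndex, hi]
  have hext : ∀ j, Function.extend (fun j (i : Fin d) => ((cornerIndex dir j i : ℕ) : ℝ)) q 0
      (fun i => ((cornerIndex dir j i : ℕ) : ℝ)) = q j :=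
    fun j => (cornerPoint_injective dir).extend_apply q 0 j
  obtain ⟨_, ⟨j, rfl⟩, _, ⟨j', rfl⟩, hne⟩ := hφ (Set.range q)
    ⟨ncard_range_of_injective hq, Function.extend _ q 0, by
      rintro _ ⟨j, rfl⟩
      exact ⟨j, (hext j).symm⟩, by
      rintro _ ⟨j, rfl⟩
      exact ⟨_, ⟨j, rfl⟩, hext j⟩, by
      rintro _ ⟨j, rfl⟩ _ ⟨j', rfl⟩ i hi
      rw [hext, hext]
      have : cornerIndex dir j i = cornerIndex dir j' i := Fin.ext (Nat.cast_injective hi)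
      simp only [q, this]⟩
  exact hne ((hcol j).trans (hcol j').symm)

theorem hgColorable_cornerTemplate {k d : ℕ} (dir : Fin (k + 1) → Fin d)
    (hdir : ∀ i, ∃ j, j ≠ 0 ∧ dir j = i) {K : Type} (h : HasLineColoring d ℝ K) :
    HGColorable (templateEdges (k + 1) (B := fun _ : Fin d => ℝ) (cornerTemplate dir)) #K := by
  obtain ⟨g, hg⟩ := h
  refine ⟨K, g, le_rfl, ?_⟩
  rintro Q ⟨hcard, f, hmaps, hsurj, hcoord⟩
  let q : Fin (k + 1) → Fin d → ℝ := fun j => f fun i => ((cornerIndex dir j i : ℕ) : ℝ)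
  have hQ : Q = Set.range q := by
    ext x
    constructor
    · intro hx
      obtain ⟨_, ⟨j, rfl⟩, rfl⟩ := hsurj hx
      exact ⟨j, rfl⟩
    · rintro ⟨j, rfl⟩
      exact hmaps ⟨j, rfl⟩
  have hq : Function.Injective q := by
    rw [← Set.injOn_univ, ← Set.ncard_image_iff, Set.image_univ, ← hQ, hcard]
    simp
  obtain ⟨i, hi⟩ := hg (q 0)
  obtain ⟨j, hj, rfl⟩ := hdir i
  refine ⟨q j, hmaps ⟨j, rfl⟩, q 0, hmaps ⟨0, rfl⟩, fun hcol => hj (hq (hi _ ?_ hcol))⟩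
  intro i hi
  refine hcoord _ ⟨j, rfl⟩ _ ⟨0, rfl⟩ i ?_
  simp [cornerIndex, hi]

theorem aleph0_le_of_aleph0_le_cardSucc {κ : Cardinal} {m : ℕ} (h : ℵ₀ ≤ cardSucc κ m) :
    ℵ₀ ≤ κ := by
  induction m with
  | zero => exact h
  | succ m ih =>
    rw [cardSucc_succ] at h
    refine ih ?_
    by_contra! hlt
    exact h.not_gt (isSuccLimit_aleph0.succ_lt hlt)

theorem exists_cardSucc_eq {κ μ : Cardinal} {m : ℕ} (h1 : κ ≤ μ) (h2 : μ ≤ cardSucc κ m) :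
    ∃ n ≤ m, μ = cardSucc κ n := by
  induction m with
  | zero => exact ⟨0, le_rfl, h2.antisymm h1⟩
  | succ m ih =>
    rcases le_or_gt μ (cardSucc κ m) with h | h
    · obtain ⟨n, hn, e⟩ := ih h
      exact ⟨n, hn.trans m.le_succ, e⟩
    · refine ⟨m + 1, le_rfl, h2.antisymm ?_⟩
      rw [cardSucc_succ]
      exact Order.succ_le_of_lt h

/-- Corollary 1.6: if `κ ≤ 2^{ℵ₀} ≤ κ^{+(k-2)}`, then some
template hypergraph `L(ℝ^d, P)` (with `P` a `d`-dimensional `k`-template) has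
chromatic number exactly `κ`. -/
theorem statement13 (k : ℕ) (hk : 2 ≤ k) (κ : Cardinal)
    (h1 : κ ≤ Cardinal.continuum) (h2 : Cardinal.continuum ≤ cardSucc κ (k - 2)) :
    ∃ d : ℕ, 1 ≤ d ∧ ∃ P : Set (Fin d → ℝ), P.ncard = k ∧
      chrNum (templateEdges k (B := fun _ : Fin d => ℝ) P) = κ := by
  have hκ : ℵ₀ ≤ κ := aleph0_le_of_aleph0_le_cardSucc (aleph0_le_continuum.trans h2)
  obtain ⟨m, hm, hc⟩ := exists_cardSucc_eq h1 h2
  obtain ⟨k, rfl⟩ : ∃ k', k = k' + 1 := ⟨k - 1, by omega⟩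
  let dir : Fin (k + 1) → Fin (m + 1) := fun j => ⟨min (j - 1) m, by omega⟩
  refine ⟨m + 1, by omega, cornerTemplate dir,
    ncard_range_of_injective (cornerPoint_injective dir), ?_⟩
  have hcol : HGColorable
      (templateEdges (k + 1) (B := fun _ : Fin (m + 1) => ℝ) (cornerTemplate dir)) κ := by
    rw [← mk_out κ]
    refine hgColorable_cornerTemplate dir (fun i => ⟨⟨i + 1, by omega⟩, ?_, ?_⟩)
      (hasLineColoring_of_le (by rwa [mk_out]) m ℝ ?_)
    · exact fun h => Nat.succ_ne_zero _ (congrArg Fin.val h)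
    · simp only [dir, Fin.ext_iff]
      omega
    · rw [mk_out, mk_real, hc]
  refine le_antisymm (csInf_le' hcol) (le_csInf ⟨κ, hcol⟩ fun μ hμ => ?_)
  by_contra! hlt
  refine not_hgColorable_cornerTemplate dir (fun C hC => ?_) hμ
  rcases lt_or_ge μ ℵ₀ with hfin | hinf
  · have : Finite C := lt_aleph0_iff_finite.1 (hC.trans_lt hfin)
    obtain ⟨X, hX, h⟩ := exists_finite_hasCorner k C (m + 1)
    obtain ⟨ι⟩ : Nonempty (X ↪ ℝ) := by
      rw [← Cardinal.le_def, mk_real]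
      exact (lt_aleph0_of_finite X).le.trans aleph0_le_continuum
    exact h.of_injective ι ι.injective
  · refine hasCorner_of_aleph0_le hinf hC (m + 1) ℝ ?_
    rw [mk_real, hc, cardSucc_succ_left]
    exact cardSucc_mono m (Order.succ_le_of_lt hlt)
end

section
/- Let P be a d-dimensional k-template (d ≥ 1, k ≥ 2) and let e = e(P). There is a simple e-dimensional k-template Q such that for every nonempty set X, the hypergraph L(X^e,Q) is embeddable into L(X^d,P). -/
open Cardinal

/-- A template has a distinguisher of the least possible cardinality `eDim P`. -/
theorem exists_isDistinguisher_card_eq_eDim {d : ℕ} {A : Type} (P : Set (Fin d → A)) :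
    ∃ I : Finset (Fin d), IsDistinguisher P I ∧ I.card = eDim P := by
  refine Nat.sInf_mem (s := {e | ∃ I : Finset (Fin d), IsDistinguisher P I ∧ I.card = e}) ?_
  exact ⟨_, Finset.univ, fun x _ y _ hxy => by simpa using Function.ne_iff.mp hxy, rfl⟩

theorem IsDistinguisher.eDim_le_card {d : ℕ} {A : Type} {P : Set (Fin d → A)}
    {I : Finset (Fin d)} (hI : IsDistinguisher P I) : eDim P ≤ I.card :=
  Nat.sInf_le ⟨I, hI, rfl⟩

/-- Restriction of coordinates to a distinguisher is injective on the template. -/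
theorem IsDistinguisher.injOn_comp {d e : ℕ} {A : Type} {P : Set (Fin d → A)}
    {I : Finset (Fin d)} (hI : IsDistinguisher P I) {σ : Fin e → Fin d}
    (hσ : Set.range σ = I) : Set.InjOn (fun x : Fin d → A => x ∘ σ) P := by
  intro x hx y hy hxy
  by_contra hne
  obtain ⟨i, hi, hi'⟩ := hI x hx y hy hne
  obtain ⟨j, rfl⟩ : i ∈ Set.range σ := hσ ▸ hi
  exact hi' (congrFun hxy j)

/-- Restricting a template to a distinguisher of minimal cardinality gives a simple template. -/
theorem IsDistinguisher.isSimple_image_comp {d e : ℕ} {A : Type} {P : Set (Fin d → A)}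
    {I : Finset (Fin d)} (hI : IsDistinguisher P I) (hcard : I.card = eDim P)
    {σ : Fin e → Fin d} (hinj : Function.Injective σ) (hσ : Set.range σ = I) :
    IsSimple ((fun x : Fin d → A => x ∘ σ) '' P) := by
  intro m
  have hm : σ m ∈ I := by
    rw [← Finset.mem_coe, ← hσ]
    exact Set.mem_range_self m
  have hnot : ¬ IsDistinguisher P (I.erase (σ m)) := fun h =>
    absurd (h.eDim_le_card.trans_lt (Finset.card_erase_lt_of_mem hm)) (by omega)
  unfold IsDistinguisher at hnot
  push Not at hnot
  obtain ⟨x, hx, y, hy, hne, heq⟩ := hnot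
  refine ⟨_, ⟨x, hx, rfl⟩, _, ⟨y, hy, rfl⟩, fun i => ⟨?_, fun hi => ?_⟩⟩
  · rintro hxy rfl
    obtain ⟨j, hj, hj'⟩ := hI x hx y hy hne
    by_cases hji : j = σ i
    · exact hj' (hji ▸ hxy)
    · exact hj' (heq j (Finset.mem_erase.mpr ⟨hji, hj⟩))
  · refine heq (σ i) (Finset.mem_erase.mpr ⟨hinj.ne hi, ?_⟩)
    rw [← Finset.mem_coe, ← hσ]
    exact Set.mem_range_self i

/-- The template hypergraph of a restriction of `P` to some of its coordinates embeds into the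
template hypergraph of `P`, by keeping the remaining coordinates constant. -/
theorem hgContains_templateEdges_image_comp {d e : ℕ} (k : ℕ) {A : Type} (P : Set (Fin d → A))
    {σ : Fin e → Fin d} (hinj : Function.Injective σ) (X : Type) [Nonempty X] :
    HGContains
      (templateEdges k (B := fun _ : Fin e => X) ((fun x : Fin d → A => x ∘ σ) '' P))
      (templateEdges k (B := fun _ : Fin d => X) P) := by
  obtain ⟨x₀⟩ := ‹Nonempty X›
  have hF : Function.Injective
      (fun z : Fin e → X => Function.extend σ z fun _ => x₀) := fun z w hzw => by
    funext i
    simpa [hinj.extend_apply] using congrFun hzw (σ i)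
  refine ⟨_, hF, ?_⟩
  rintro R ⟨hR, g, hmaps, hsurj, hg⟩
  refine ⟨(Set.ncard_image_of_injective R hF).trans hR,
    fun x => Function.extend σ (g (x ∘ σ)) fun _ => x₀, fun x hx => ?_, ?_, ?_⟩
  · exact ⟨_, hmaps ⟨x, hx, rfl⟩, rfl⟩
  · rintro _ ⟨r, hr, rfl⟩
    obtain ⟨_, ⟨x, hx, rfl⟩, rfl⟩ := hsurj hr
    exact ⟨x, hx, rfl⟩
  · intro x hx y hy i hxy
    by_cases hi : ∃ j, σ j = i
    · obtain ⟨j, rfl⟩ := hi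
      simpa only [hinj.extend_apply] using hg _ ⟨x, hx, rfl⟩ _ ⟨y, hy, rfl⟩ j hxy
    · simp only [Function.extend_apply' _ _ _ hi]

/-- Lemma 1.9: for any `d`-dimensional `k`-template `P`
there is a simple `e(P)`-dimensional `k`-template `Q` such that for every
nonempty set `X`, `L(X^{e(P)}, Q)` embeds into `L(X^d, P)`. -/
theorem statement14 (d k : ℕ) (hd : 1 ≤ d) (hk : 2 ≤ k)
    (A : Type) (P : Set (Fin d → A)) (hP : P.ncard = k) :
    ∃ Q : Set (Fin (eDim P) → A), IsSimple Q ∧ Q.ncard = k ∧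
      ∀ X : Type, Nonempty X →
        HGContains (templateEdges k (B := fun _ : Fin (eDim P) => X) Q)
          (templateEdges k (B := fun _ : Fin d => X) P) := by
  obtain ⟨I, hI, hcard⟩ := exists_isDistinguisher_card_eq_eDim P
  have hrange : Set.range (I.orderEmbOfFin hcard) = I := I.range_orderEmbOfFin hcard
  have hinj : Function.Injective (I.orderEmbOfFin hcard) := (I.orderEmbOfFin hcard).injective
  refine ⟨(fun x : Fin d → A => x ∘ I.orderEmbOfFin hcard) '' P,
    hI.isSimple_image_comp hcard hinj hrange,
    (hI.injOn_comp hrange).ncard_image.trans hP, fun X hX => ?_⟩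
  exact hgContains_templateEdges_image_comp k P hinj X
end

section
/- If P is a simple d-dimensional k-template (d ≥ 1, k ≥ 2), then k ≥ d + 1. -/
open Cardinal

/-- The restrictions of a nonempty finite simple template to a set `S` of coordinates take at
least `|S| + 1` values. -/
theorem IsSimple.card_lt_ncard_image_restrict {d : ℕ} {A : Type} {P : Set (Fin d → A)}
    (hP : IsSimple P) (hfin : P.Finite) (hne : P.Nonempty) (S : Finset (Fin d)) :
    S.card < (S.restrict '' P).ncard := by
  classical
  induction S using Finset.induction_on with
  | empty => simpa [Set.ncard_pos (hfin.image _)] using hne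
  | insert m S hm ih =>
    obtain ⟨x, hx, y, hy, hxy⟩ := hP m
    let r := Finset.restrict₂ (π := fun _ => A) (Finset.subset_insert m S)
    have himage : r '' ((insert m S).restrict '' P) = S.restrict '' P := Set.image_image ..
    have hlt : (S.restrict '' P).ncard < ((insert m S).restrict '' P).ncard := by
      rw [← himage]
      refine lt_of_le_of_ne (Set.ncard_image_le (hfin.image _)) fun h => ?_
      have hinj := Set.injOn_of_ncard_image_eq h (hfin.image _)
      have heq := hinj (Set.mem_image_of_mem _ hx) (Set.mem_image_of_mem _ hy) <| by
        funext i
        exact (hxy i).2 fun him => hm (him ▸ i.2)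
      exact (hxy m).1 (congrFun heq ⟨m, Finset.mem_insert_self m S⟩) rfl
    rw [Finset.card_insert_of_notMem hm]
    omega

/-- a simple `d`-dimensional `k`-template satisfies `k ≥ d + 1`. -/
theorem statement17 (d k : ℕ) (hd : 1 ≤ d) (hk : 2 ≤ k)
    (A : Type) (P : Set (Fin d → A)) (hP : P.ncard = k) (hsimple : IsSimple P) :
    d + 1 ≤ k := by
  have hfin : P.Finite := Set.finite_of_ncard_ne_zero (by omega)
  have hne : P.Nonempty := Set.nonempty_of_ncard_ne_zero (by omega)
  have hlt := hsimple.card_lt_ncard_image_restrict hfin hne Finset.univ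
  have hle := Set.ncard_image_le (f := Finset.univ.restrict) hfin
  rw [Finset.card_univ, Fintype.card_fin] at hlt
  omega
end

section
/- Let G be the graph with vertex set ℝ² in which distinct points a = (a_0,a_1) and b = (b_0,b_1) are adjacent if and only if a_1 = b_0 or b_1 = a_0. Then χ(G) = ℵ₀; that is, G has a proper coloring with countably many colors but no proper coloring with finitely many colors. -/
open Cardinal

/-- The edge set of the zero graph of the `(2,2)`-ary polynomial `x_1 − y_0`:
distinct points `a, b ∈ ℝ²` are adjacent iff `a_1 = b_0` or `b_1 = a_0`. -/
def shiftGraphEdges : Set (Set (ℝ × ℝ)) :=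
  {e | ∃ a b : ℝ × ℝ, a ≠ b ∧ (a.2 = b.1 ∨ b.2 = a.1) ∧ e = {a, b}}

/-- The shift graph on `ℝ²` has a proper coloring by `Fin 3 × ℚ`: record the order type of the
two coordinates and, off the diagonal, a rational strictly between them. -/
theorem exists_countable_shift_coloring :
    ∃ φ : ℝ × ℝ → Fin 3 × ℚ,
      ∀ a b : ℝ × ℝ, a ≠ b → (a.2 = b.1 ∨ b.2 = a.1) → φ a ≠ φ b := by
  have key : ∀ a : ℝ × ℝ, ∃ c : Fin 3 × ℚ,
      (c.1 = 0 ∧ a.1 < c.2 ∧ (c.2 : ℝ) < a.2) ∨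
      (c.1 = 1 ∧ a.2 < c.2 ∧ (c.2 : ℝ) < a.1) ∨ (c.1 = 2 ∧ a.1 = a.2) := by
    intro a
    rcases lt_trichotomy a.1 a.2 with h | h | h
    · obtain ⟨q, hq⟩ := exists_rat_btwn h
      exact ⟨(0, q), Or.inl ⟨rfl, hq⟩⟩
    · exact ⟨(2, 0), Or.inr (Or.inr ⟨rfl, h⟩)⟩
    · obtain ⟨q, hq⟩ := exists_rat_btwn h
      exact ⟨(1, q), Or.inr (Or.inl ⟨rfl, hq⟩)⟩
  choose φ hφ using key
  refine ⟨φ, fun a b hab hadj heq => ?_⟩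
  have ha := hφ a
  have hb := hφ b
  rw [← heq] at hb
  rcases ha with ⟨h, h1, h2⟩ | ⟨h, h1, h2⟩ | ⟨h, h1⟩ <;>
    rcases hb with ⟨h', h3, h4⟩ | ⟨h', h3, h4⟩ | ⟨h', h3⟩ <;>
    first
    | (rw [h] at h'; exact absurd h' (by decide))
    | (rcases hadj with e | e <;> linarith)
    | (apply hab; ext <;> rcases hadj with e | e <;> linarith)

/-- Every finite coloring of `ℝ²` is constant on some edge of the shift graph. -/
theorem exists_monochromatic_shift_edge (C : Type) (φ : ℝ × ℝ → C) [Finite C] :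
    ∃ a b : ℝ × ℝ, a ≠ b ∧ (a.2 = b.1 ∨ b.2 = a.1) ∧ φ a = φ b := by
  let S : ℕ → Set C := fun n => {c | ∃ m : ℕ, n < m ∧ φ (n, m) = c}
  obtain ⟨n, m, hnm, hS⟩ : ∃ n m : ℕ, n < m ∧ S n = S m := by
    obtain ⟨n, m, hne, hS⟩ := Finite.exists_ne_map_eq_of_infinite S
    rcases hne.lt_or_gt with h | h
    · exact ⟨n, m, h, hS⟩
    · exact ⟨m, n, h, hS.symm⟩
  have hmem : φ (n, m) ∈ S n := ⟨m, hnm, rfl⟩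
  rw [hS] at hmem
  obtain ⟨k, -, hk⟩ := hmem
  refine ⟨(n, m), (m, k), fun h => ?_, Or.inl rfl, hk.symm⟩
  exact hnm.ne (Nat.cast_injective (congrArg Prod.fst h))

/-- A coloring of the shift hypergraph separates the endpoints of every edge. -/
theorem hgColorable_shiftGraphEdges_iff (κ : Cardinal) :
    HGColorable shiftGraphEdges κ ↔ ∃ (C : Type) (φ : ℝ × ℝ → C), #C ≤ κ ∧
      ∀ a b : ℝ × ℝ, a ≠ b → (a.2 = b.1 ∨ b.2 = a.1) → φ a ≠ φ b := by
  refine exists_congr fun C => exists_congr fun φ => and_congr_right fun _ => ⟨?_, ?_⟩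
  · intro h a b hab hadj heq
    obtain ⟨x, hx, y, hy, hxy⟩ := h {a, b} ⟨a, b, hab, hadj, rfl⟩
    rcases hx with rfl | rfl <;> rcases hy with rfl | rfl <;> simp_all
  · rintro h e ⟨a, b, hab, hadj, rfl⟩
    exact ⟨a, by simp, b, by simp, h a b hab hadj⟩

/-- the graph on `ℝ²` where distinct `a, b` are adjacent iff
`a_1 = b_0` or `b_1 = a_0` has chromatic number exactly `ℵ₀`: it has a proper
coloring with countably many colors but none with finitely many colors. -/
theorem statement19 :
    chrNum shiftGraphEdges = Cardinal.aleph0 ∧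
      (∃ (C : Type) (φ : ℝ × ℝ → C), #C ≤ Cardinal.aleph0 ∧
        ∀ a b : ℝ × ℝ, a ≠ b → (a.2 = b.1 ∨ b.2 = a.1) → φ a ≠ φ b) ∧
      (∀ (C : Type) (φ : ℝ × ℝ → C), Finite C →
        ∃ a b : ℝ × ℝ, a ≠ b ∧ (a.2 = b.1 ∨ b.2 = a.1) ∧ φ a = φ b) := by
  obtain ⟨φ, hφ⟩ := exists_countable_shift_coloring
  have hcount : ∃ (C : Type) (φ : ℝ × ℝ → C), #C ≤ Cardinal.aleph0 ∧
      ∀ a b : ℝ × ℝ, a ≠ b → (a.2 = b.1 ∨ b.2 = a.1) → φ a ≠ φ b :=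
    ⟨_, φ, Cardinal.mk_le_aleph0, hφ⟩
  have hcol := (hgColorable_shiftGraphEdges_iff _).2 hcount
  refine ⟨le_antisymm (csInf_le' hcol) (le_csInf ⟨_, hcol⟩ fun κ hκ => ?_), hcount,
    fun C φ _ => exists_monochromatic_shift_edge C φ⟩
  obtain ⟨C, ψ, hC, hψ⟩ := (hgColorable_shiftGraphEdges_iff κ).1 hκ
  by_contra! hlt
  have : Finite C := Cardinal.lt_aleph0_iff_finite.1 (hC.trans_lt hlt)
  obtain ⟨a, b, hab, hadj, heq⟩ := exists_monochromatic_shift_edge C ψ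
  exact hψ a b hab hadj heq
end
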